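/- arXiv:0709.2523 — 4 statements merged into one kernel-verified Lean document; each statement's English description precedes it below -/
import Mathlib

section
/- Let f : ℝ × ℝ → ℝ, (s,ε) ↦ f(s,ε), be of class C¹, let t > 0, and let Ω₀ : ℝ → ℝ be of class C¹ with Ω₀(0) = 0. Define the asynchronous variation of the integrand by Δf(s) := (d/dε)[ f(s + ε·Ω₀(s), ε) ]|_{ε=0} and the asynchronous variation of the functional J(ε) := ∫₀^{t + ε·Ω₀(t)} f(s,ε) ds by ΔJ := (dJ/dε)|_{ε=0}. Then ΔJ = ∫₀^t ( Δf(s) + f(s,0)·Ω₀′(s) ) ds. (Lemma 2.1: the asynchronous variation of J = ∫ f dt is ΔJ = ∫ (Δf + f·Ω̇₀) dt, exhibiting the non-commutativity of the Δ-operation with integration.) -/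
/-!
Lemma 2.1 (asynchronous variation of a functional).
`f (s, ε)` is the integrand along the varied path, the time along the varied
path being `s + ε • Ω₀ s`; `J ε = ∫ s in 0..(t + ε * Ω₀ t), f (s, ε)` is the
functional, and the lemma states `ΔJ = ∫ s in 0..t, (Δf s + f (s,0) * Ω₀' s)`.
-/

/-- Differentiation under the integral sign for a continuously differentiable integrand. -/
theorem hasDerivAt_intervalIntegral_of_contDiff {E : Type*} [NormedAddCommGroup E]
    [NormedSpace ℝ E] {G : ℝ × ℝ → E} (hG : ContDiff ℝ 1 G) (a b ε₀ : ℝ) :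
    HasDerivAt (fun ε => ∫ s in a..b, G (s, ε)) (∫ s in a..b, fderiv ℝ G (s, ε₀) (0, 1)) ε₀ := by
  have hG' : Continuous fun p => fderiv ℝ G p (0, 1) :=
    (hG.continuous_fderiv one_ne_zero).clm_apply continuous_const
  obtain ⟨C, hC⟩ := (isCompact_uIcc.prod (isCompact_Icc (a := ε₀ - 1) (b := ε₀ + 1))
    |>.exists_bound_of_continuousOn (s := Set.uIcc a b ×ˢ _) hG'.continuousOn)
  refine (intervalIntegral.hasDerivAt_integral_of_dominated_loc_of_deriv_le
    (F := fun ε s => G (s, ε)) (F' := fun ε s => fderiv ℝ G (s, ε) (0, 1)) (bound := fun _ => C)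
    (Icc_mem_nhds (sub_one_lt ε₀) (lt_add_one ε₀)) (.of_forall fun ε => ?_) ?_ ?_ ?_
    intervalIntegrable_const ?_).2
  · exact (hG.continuous.comp (by fun_prop)).aestronglyMeasurable
  · exact (hG.continuous.comp (by fun_prop)).intervalIntegrable _ _
  · exact (hG'.comp (by fun_prop : Continuous fun s : ℝ => (s, ε₀))).aestronglyMeasurable
  · exact .of_forall fun s hs ε hε => hC (s, ε) ⟨Set.uIoc_subset_uIcc hs, hε⟩
  · refine .of_forall fun s _ ε _ => ?_
    exact ((hG.differentiable one_ne_zero (s, ε)).hasFDerivAt.comp_hasDerivAt ε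
      ((hasDerivAt_const ε s).prodMk (hasDerivAt_id ε)))

/-- The asynchronous variation at time `s` when the time variation there is `w`. -/
theorem hasDerivAt_comp_time_variation {f : ℝ × ℝ → ℝ} (hf : ContDiff ℝ 1 f) (s w : ℝ) :
    HasDerivAt (fun ε : ℝ => f (s + ε * w, ε)) (fderiv ℝ f (s, 0) (w, 1)) 0 := by
  have hγ : HasDerivAt (fun ε : ℝ => (s + ε * w, ε)) (w, 1) 0 := by
    simpa using (((hasDerivAt_id (0 : ℝ)).mul_const w).const_add s).prodMk (hasDerivAt_id 0)
  exact HasFDerivAt.comp_hasDerivAt_of_eq 0 (hf.differentiable one_ne_zero (s, 0)).hasFDerivAt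
    hγ (by simp)

/-- Rescaling the time linearly turns the moving endpoint into a fixed one. -/
theorem hasDerivAt_integral_moving_endpoint {f : ℝ × ℝ → ℝ} (hf : ContDiff ℝ 1 f) (t k : ℝ) :
    HasDerivAt (fun ε : ℝ => ∫ s in (0:ℝ)..(t + ε * (k * t)), f (s, ε))
      (∫ s in (0:ℝ)..t, (fderiv ℝ f (s, 0) (k * s, 1) + f (s, 0) * k)) 0 := by
  have hG : ContDiff ℝ 1 fun p : ℝ × ℝ => f (p.1 + p.2 * (k * p.1), p.2) * (1 + p.2 * k) :=
    (hf.comp (by fun_prop)).mul (by fun_prop)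
  refine ((hasDerivAt_intervalIntegral_of_contDiff hG 0 t 0).congr_deriv ?_).congr_of_eventuallyEq
    (.of_forall fun ε => ?_)
  · refine intervalIntegral.integral_congr fun s _ => ?_
    have h₁ := (hG.differentiable one_ne_zero (s, 0)).hasFDerivAt.comp_hasDerivAt 0
      ((hasDerivAt_const 0 s).prodMk (hasDerivAt_id 0))
    have h₂ := (hasDerivAt_comp_time_variation hf s (k * s)).mul
      (((hasDerivAt_id (0 : ℝ)).mul_const k).const_add 1)
    simpa using h₁.unique h₂
  · have h := intervalIntegral.mul_integral_comp_mul_right (a := 0) (b := t)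
      (f := fun s => f (s, ε)) (1 + ε * k)
    rw [zero_mul, show t * (1 + ε * k) = t + ε * (k * t) by ring] at h
    simp only [intervalIntegral.integral_mul_const]
    rw [← h, mul_comm]
    simp only [mul_add, mul_one, mul_left_comm, mul_comm]

theorem async_variation_of_functional
    (f : ℝ × ℝ → ℝ) (hf : ContDiff ℝ 1 f)
    (t : ℝ) (ht : 0 < t)
    (Ω₀ : ℝ → ℝ) (hΩ : ContDiff ℝ 1 Ω₀) (hΩ0 : Ω₀ 0 = 0) :
    deriv (fun ε : ℝ => ∫ s in (0:ℝ)..(t + ε * Ω₀ t), f (s, ε)) 0 =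
      ∫ s in (0:ℝ)..t,
        (deriv (fun ε : ℝ => f (s + ε * Ω₀ s, ε)) 0 + f (s, 0) * deriv Ω₀ s) := by
  obtain ⟨k, hk⟩ : ∃ k, Ω₀ t = k * t := ⟨Ω₀ t / t, by field_simp⟩
  have hf' := hf.continuous_fderiv one_ne_zero
  have hfc := hf.continuous
  have hΩ' := hΩ.continuous_deriv le_rfl
  have hΩc := hΩ.continuous
  simp only [(hasDerivAt_comp_time_variation hf _ _).deriv]
  rw [hk, (hasDerivAt_integral_moving_endpoint hf t k).deriv, eq_comm, ← sub_eq_zero,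
    ← intervalIntegral.integral_sub (Continuous.intervalIntegrable (by fun_prop) _ _)
      (Continuous.intervalIntegrable (by fun_prop) _ _)]
  have hF (s : ℝ) : HasDerivAt (fun s => f (s, 0) * (Ω₀ s - k * s))
      (fderiv ℝ f (s, 0) (Ω₀ s, 1) + f (s, 0) * deriv Ω₀ s -
        (fderiv ℝ f (s, 0) (k * s, 1) + f (s, 0) * k)) s := by
    have h₁ := (hf.differentiable one_ne_zero (s, 0)).hasFDerivAt.comp_hasDerivAt s
      ((hasDerivAt_id s).prodMk (hasDerivAt_const s (0 : ℝ)))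
    have h₂ := (hΩ.differentiable one_ne_zero s).hasDerivAt.sub ((hasDerivAt_id s).const_mul k)
    have h₃ : fderiv ℝ f (s, 0) (Ω₀ s, 1) - fderiv ℝ f (s, 0) (k * s, 1) =
        (Ω₀ s - k * s) * fderiv ℝ f (s, 0) (1, 0) := by
      rw [← map_sub, ← smul_eq_mul (Ω₀ s - k * s), ← map_smul]
      simp
    refine (h₁.mul h₂).congr_deriv ?_
    simp only [Function.comp_apply, Pi.sub_apply, id_eq, mul_one]
    linear_combination -h₃
  rw [intervalIntegral.integral_eq_sub_of_hasDerivAt (fun s _ => hF s)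
    (Continuous.intervalIntegrable (by fun_prop) _ _)]
  simp [hk, hΩ0]
end

section
/- Let x : ℝ × ℝ → ℝⁿ, (t,ε) ↦ x(t,ε), be a C² two-parameter family, and let η_p(t,ε) and ω_p(t,ε) be the (unique, by pointwise linear independence of ξ_1(x),…,ξ_n(x)) coefficients with ∂_t x = ξ_0(x,t) + η_p ξ_p(x) and ∂_ε x = ω_p ξ_p(x). Then the transpositional relations δη_p = dω_p/dt + C_{0q}^p ω_q + C_{qr}^p η_q ω_r hold identically in (t,ε), where δη_p := ∂_ε η_p and dω_p/dt := ∂_t ω_p, and the structure functions are evaluated at (x(t,ε), t). -/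
open scoped BigOperators

namespace NNH

/-- Full index type for `p, q, r = 1,…,n`: `Sum.inl i` are the independent
indices `i, j, k = 1,…,m` and `Sum.inr α` the dependent ones
`α, β = m+1,…,n` (so `n = m + κ`). -/
abbrev Idx (m κ : ℕ) := Fin m ⊕ Fin κ

variable {m κ : ℕ}

/-- Partial derivative of `f : (ι → ℝ) → ℝ` in the `i`-th coordinate at `v`. -/
noncomputable def pd {ι : Type*} [DecidableEq ι] (f : (ι → ℝ) → ℝ) (i : ι) (v : ι → ℝ) : ℝ :=
  deriv (fun s => f (Function.update v i s)) (v i)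

/-- The operator `X_p G = ξ_p^q ∂G/∂x_q` (differentiation in `x` only). -/
noncomputable def Xp (ξ : Idx m κ → (Idx m κ → ℝ) → Idx m κ → ℝ) (p : Idx m κ)
    (G : (Idx m κ → ℝ) → ℝ → ℝ) : (Idx m κ → ℝ) → ℝ → ℝ :=
  fun x t => ∑ q, ξ p x q * pd (fun v => G v t) q x

/-- The operator `X₀ G = ∂G/∂t + ξ₀^q ∂G/∂x_q`. -/
noncomputable def X0 (ξ0 : (Idx m κ → ℝ) → ℝ → Idx m κ → ℝ)
    (G : (Idx m κ → ℝ) → ℝ → ℝ) : (Idx m κ → ℝ) → ℝ → ℝ :=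
  fun x t => deriv (fun s => G x s) t + ∑ q, ξ0 x t q * pd (fun v => G v t) q x

/-- `∂f/∂η_p` for a function `f(η, x, t)`. -/
noncomputable def pEta (f : (Idx m κ → ℝ) → (Idx m κ → ℝ) → ℝ → ℝ) (p : Idx m κ)
    (η x : Idx m κ → ℝ) (t : ℝ) : ℝ :=
  pd (fun w => f w x t) p η

/-- `∂φ_α/∂η_j`. -/
noncomputable def dphi (φ : Fin κ → (Fin m → ℝ) → (Idx m κ → ℝ) → ℝ → ℝ)
    (α : Fin κ) (j : Fin m) (v : Fin m → ℝ) (x : Idx m κ → ℝ) (t : ℝ) : ℝ :=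
  pd (fun w => φ α w x t) j v

/-- The full vector of Poincaré parameters obtained from the independent ones
`v = (η_1,…,η_m)` by imposing the constraints `η_α = φ_α(v, x, t)`. -/
noncomputable def etaExt (φ : Fin κ → (Fin m → ℝ) → (Idx m κ → ℝ) → ℝ → ℝ)
    (v : Fin m → ℝ) (x : Idx m κ → ℝ) (t : ℝ) : Idx m κ → ℝ :=
  Sum.elim v fun α => φ α v x t

/-- `K_{0j}^s := C_{0j}^s + C_{0β}^s ∂φ_β/∂η_j`. -/
noncomputable def K0 (C0 : Idx m κ → Idx m κ → (Idx m κ → ℝ) → ℝ → ℝ)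
    (φ : Fin κ → (Fin m → ℝ) → (Idx m κ → ℝ) → ℝ → ℝ)
    (j : Fin m) (s : Idx m κ) (v : Fin m → ℝ) (x : Idx m κ → ℝ) (t : ℝ) : ℝ :=
  C0 (.inl j) s x t + ∑ β, C0 (.inr β) s x t * dphi φ β j v x t

/-- `K_{qj}^s := C_{qj}^s + C_{qβ}^s ∂φ_β/∂η_j`. -/
noncomputable def Kq (C : Idx m κ → Idx m κ → Idx m κ → (Idx m κ → ℝ) → ℝ → ℝ)
    (φ : Fin κ → (Fin m → ℝ) → (Idx m κ → ℝ) → ℝ → ℝ)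
    (q : Idx m κ) (j : Fin m) (s : Idx m κ) (v : Fin m → ℝ) (x : Idx m κ → ℝ) (t : ℝ) : ℝ :=
  C q (.inl j) s x t + ∑ β, C q (.inr β) s x t * dphi φ β j v x t

/-- `X*_j G := X_j G + (∂φ_β/∂η_j) X_β G`. -/
noncomputable def Xstar (ξ : Idx m κ → (Idx m κ → ℝ) → Idx m κ → ℝ)
    (φ : Fin κ → (Fin m → ℝ) → (Idx m κ → ℝ) → ℝ → ℝ)
    (j : Fin m) (G : (Idx m κ → ℝ) → ℝ → ℝ)
    (v : Fin m → ℝ) (x : Idx m κ → ℝ) (t : ℝ) : ℝ :=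
  Xp ξ (.inl j) G x t + ∑ β, dphi φ β j v x t * Xp ξ (.inr β) G x t

/-- The reduced Lagrangian `L*(η_1,…,η_m, x, t) = L(η_i, φ_α(η_i,x,t), x, t)`. -/
noncomputable def Lstar (L : (Idx m κ → ℝ) → (Idx m κ → ℝ) → ℝ → ℝ)
    (φ : Fin κ → (Fin m → ℝ) → (Idx m κ → ℝ) → ℝ → ℝ)
    (v : Fin m → ℝ) (x : Idx m κ → ℝ) (t : ℝ) : ℝ :=
  L (etaExt φ v x t) x t

/-- `∂L*/∂η_j`. -/
noncomputable def pLstar (L : (Idx m κ → ℝ) → (Idx m κ → ℝ) → ℝ → ℝ)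
    (φ : Fin κ → (Fin m → ℝ) → (Idx m κ → ℝ) → ℝ → ℝ)
    (j : Fin m) (v : Fin m → ℝ) (x : Idx m κ → ℝ) (t : ℝ) : ℝ :=
  pd (fun w => Lstar L φ w x t) j v

/-- `(A_j^α)*` along a motion `t ↦ (xc t)` with independent parameters `t ↦ vm t`. -/
noncomputable def Astar (ξ : Idx m κ → (Idx m κ → ℝ) → Idx m κ → ℝ)
    (C0 : Idx m κ → Idx m κ → (Idx m κ → ℝ) → ℝ → ℝ)
    (C : Idx m κ → Idx m κ → Idx m κ → (Idx m κ → ℝ) → ℝ → ℝ)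
    (φ : Fin κ → (Fin m → ℝ) → (Idx m κ → ℝ) → ℝ → ℝ)
    (xc : ℝ → Idx m κ → ℝ) (vm : ℝ → Fin m → ℝ)
    (j : Fin m) (α : Fin κ) (t : ℝ) : ℝ :=
  deriv (fun τ => dphi φ α j (vm τ) (xc τ) τ) t
    - Xstar ξ φ j (fun x' t' => φ α (vm t) x' t') (vm t) (xc t) t
    + K0 C0 φ j (.inr α) (vm t) (xc t) t
    + ∑ i, Kq C φ (.inl i) j (.inr α) (vm t) (xc t) t * vm t i
    + ∑ β, Kq C φ (.inr β) j (.inr α) (vm t) (xc t) t * φ β (vm t) (xc t) t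
    - ∑ k', (K0 C0 φ j (.inl k') (vm t) (xc t) t
        + ∑ i, Kq C φ (.inl i) j (.inl k') (vm t) (xc t) t * vm t i
        + ∑ β, Kq C φ (.inr β) j (.inl k') (vm t) (xc t) t * φ β (vm t) (xc t) t)
        * dphi φ α k' (vm t) (xc t) t

/-- Independent part of the Poincaré parameters of a motion. -/
noncomputable def vmOf (η : ℝ → Idx m κ → ℝ) (t : ℝ) : Fin m → ℝ := fun i => η t (.inl i)

/-- Left-hand side of the multiplier-free Poincaré equations of motion
`d/dt(∂L*/∂η_j) − (K_{0j}^k + K_{qj}^k η_q) ∂L*/∂η_k − X*_j L* − (A_j^α)* (∂L/∂η_α)*`. -/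
noncomputable def PoincareLHS (ξ : Idx m κ → (Idx m κ → ℝ) → Idx m κ → ℝ)
    (C0 : Idx m κ → Idx m κ → (Idx m κ → ℝ) → ℝ → ℝ)
    (C : Idx m κ → Idx m κ → Idx m κ → (Idx m κ → ℝ) → ℝ → ℝ)
    (φ : Fin κ → (Fin m → ℝ) → (Idx m κ → ℝ) → ℝ → ℝ)
    (L : (Idx m κ → ℝ) → (Idx m κ → ℝ) → ℝ → ℝ)
    (xc : ℝ → Idx m κ → ℝ) (η : ℝ → Idx m κ → ℝ)
    (j : Fin m) (t : ℝ) : ℝ :=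
  deriv (fun τ => pLstar L φ j (vmOf η τ) (xc τ) τ) t
    - ∑ k', (K0 C0 φ j (.inl k') (vmOf η t) (xc t) t
        + ∑ q, Kq C φ q j (.inl k') (vmOf η t) (xc t) t * η t q)
        * pLstar L φ k' (vmOf η t) (xc t) t
    - Xstar ξ φ j (fun x' t' => Lstar L φ (vmOf η t) x' t') (vmOf η t) (xc t) t
    - ∑ α, Astar ξ C0 C φ xc (vmOf η) j α t
        * pEta L (.inr α) (etaExt φ (vmOf η t) (xc t) t) (xc t) t

/-- The reduced Hamiltonian `H*(x, y*, t) := η_j y*_j − L*`, where `ηhat`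
inverts the Legendre transformation `y*_j = ∂L*/∂η_j`. -/
noncomputable def Hstar (L : (Idx m κ → ℝ) → (Idx m κ → ℝ) → ℝ → ℝ)
    (φ : Fin κ → (Fin m → ℝ) → (Idx m κ → ℝ) → ℝ → ℝ)
    (ηhat : (Idx m κ → ℝ) → (Fin m → ℝ) → ℝ → Fin m → ℝ)
    (x : Idx m κ → ℝ) (y : Fin m → ℝ) (t : ℝ) : ℝ :=
  (∑ j, ηhat x y t j * y j) - Lstar L φ (ηhat x y t) x t


/-- The coordinate derivative of a differentiable function is its derivative along a basis vector. -/
theorem pd_eq_fderiv {ι : Type*} [Fintype ι] [DecidableEq ι] {f : (ι → ℝ) → ℝ} {v : ι → ℝ}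
    (hf : DifferentiableAt ℝ f v) (i : ι) : pd f i v = fderiv ℝ f v (Pi.single i 1) := by
  have hu : HasDerivAt (Function.update v i) (Pi.single i 1) (v i) := hasDerivAt_update v i (v i)
  have hf' : HasFDerivAt f (fderiv ℝ f v) (Function.update v i (v i)) := by
    simpa using hf.hasFDerivAt
  exact (hf'.comp_hasDerivAt (v i) hu).deriv

theorem sum_mul_pd {ι : Type*} [Fintype ι] [DecidableEq ι] {f : (ι → ℝ) → ℝ} {v : ι → ℝ}
    (hf : DifferentiableAt ℝ f v) (w : ι → ℝ) : ∑ i, w i * pd f i v = fderiv ℝ f v w := by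
  conv_rhs => rw [pi_eq_sum_univ' w, map_sum]
  refine Finset.sum_congr rfl fun i _ => ?_
  rw [pd_eq_fderiv hf, map_smul, smul_eq_mul]

theorem Xp_eq_fderiv (ξ : Idx m κ → (Idx m κ → ℝ) → Idx m κ → ℝ) (p : Idx m κ)
    {G : (Idx m κ → ℝ) → ℝ → ℝ} {x : Idx m κ → ℝ} {t : ℝ}
    (hG : DifferentiableAt ℝ (fun v => G v t) x) :
    Xp ξ p G x t = fderiv ℝ (fun v => G v t) x (ξ p x) :=
  sum_mul_pd hG _

theorem X0_eq_fderiv (ξ0 : (Idx m κ → ℝ) → ℝ → Idx m κ → ℝ)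
    {G : (Idx m κ → ℝ) → ℝ → ℝ} {x : Idx m κ → ℝ} {t : ℝ}
    (hG : DifferentiableAt ℝ (fun v => G v t) x) :
    X0 ξ0 G x t = deriv (G x) t + fderiv ℝ (fun v => G v t) x (ξ0 x t) :=
  congrArg (deriv (G x) t + ·) (sum_mul_pd hG _)

theorem fderiv_coord {ι : Type*} [Fintype ι] (s : ι) (x w : ι → ℝ) :
    fderiv ℝ (fun v : ι → ℝ => v s) x w = w s := by
  rw [(hasFDerivAt_apply s x).fderiv]
  rfl

theorem Xp_coord (ξ : Idx m κ → (Idx m κ → ℝ) → Idx m κ → ℝ) (p s : Idx m κ) :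
    Xp ξ p (fun v _ => v s) = fun x _ => ξ p x s := by
  funext x t
  rw [Xp_eq_fderiv ξ p (differentiableAt_apply s x), fderiv_coord]

theorem X0_coord (ξ0 : (Idx m κ → ℝ) → ℝ → Idx m κ → ℝ) (s : Idx m κ) :
    X0 ξ0 (fun v _ => v s) = fun x t => ξ0 x t s := by
  funext x t
  rw [X0_eq_fderiv ξ0 (differentiableAt_apply s x), fderiv_coord]
  simp

/-- Solutions of a nonsingular linear system depend differentiably on its coefficients. -/
theorem differentiableAt_of_mulVec_eq {ι : Type*} [Fintype ι] [DecidableEq ι]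
    {M : ℝ → Matrix ι ι ℝ} {b c : ℝ → ι → ℝ} {s : ℝ}
    (hM : ∀ i j, DifferentiableAt ℝ (fun u => M u i j) s)
    (hb : ∀ i, DifferentiableAt ℝ (fun u => b u i) s)
    (hdet : ∀ u, (M u).det ≠ 0) (h : ∀ u, (M u).mulVec (c u) = b u) (i : ι) :
    DifferentiableAt ℝ (fun u => c u i) s := by
  have hdiff : ∀ N : ℝ → Matrix ι ι ℝ, (∀ j k, DifferentiableAt ℝ (fun u => N u j k) s) →
      DifferentiableAt ℝ (fun u => (N u).det) s := by
    intro N hN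
    simp only [Matrix.det_apply']
    exact DifferentiableAt.fun_sum fun σ _ =>
      (differentiableAt_const _).mul (DifferentiableAt.fun_finsetProd fun j _ => hN _ _)
  have hc : (fun u => c u i) = fun u => ((M u).updateCol i (b u)).det / (M u).det := by
    funext u
    rw [eq_div_iff (hdet u), ← Matrix.cramer_apply, ← h u, Matrix.cramer_eq_adjugate_mulVec,
      Matrix.mulVec_mulVec, Matrix.adjugate_mul, Matrix.smul_mulVec, Matrix.one_mulVec,
      Pi.smul_apply, smul_eq_mul, mul_comm]
  rw [hc]
  refine (hdiff _ fun j k => ?_).div (hdiff M hM) (hdet s)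
  by_cases hk : k = i
  · simpa [Matrix.updateCol_apply, hk] using hb j
  · simpa [Matrix.updateCol_apply, hk] using hM j k

/-- Coefficients with respect to a differentiable moving frame are differentiable. -/
theorem differentiableAt_frame_coeff {ι : Type*} [Fintype ι] [DecidableEq ι]
    {F : ι → ℝ → ι → ℝ} {b c : ι → ℝ → ℝ} {s : ℝ}
    (hF : ∀ q p, DifferentiableAt ℝ (fun u => F q u p) s)
    (hb : ∀ p, DifferentiableAt ℝ (b p) s)
    (hind : ∀ u, LinearIndependent ℝ fun q => F q u)
    (h : ∀ p u, b p u = ∑ q, c q u * F q u p) (q : ι) : DifferentiableAt ℝ (c q) s := by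
  refine differentiableAt_of_mulVec_eq (M := fun u => Matrix.of fun p q => F q u p)
    (b := fun u p => b p u) (c := fun u q => c q u) (fun p q => hF q p) hb (fun u => ?_)
    (fun u => ?_) q
  · have hunit : IsUnit (Matrix.of fun p q => F q u p) :=
      Matrix.linearIndependent_cols_iff_isUnit.mp (hind u)
    exact ((Matrix.isUnit_iff_isUnit_det _).mp hunit).ne_zero
  · funext p
    rw [h p u]
    exact Finset.sum_congr rfl fun q _ => mul_comm _ _

section MixedPartials

variable {f : ℝ × ℝ → ℝ}

theorem deriv_fst_eq_fderiv (hf : Differentiable ℝ f) (t ε : ℝ) :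
    deriv (fun τ => f (τ, ε)) t = fderiv ℝ f (t, ε) (1, 0) :=
  ((hf (t, ε)).hasFDerivAt.comp_hasDerivAt t
    ((hasDerivAt_id t).prodMk (hasDerivAt_const t ε))).deriv

theorem deriv_snd_eq_fderiv (hf : Differentiable ℝ f) (t ε : ℝ) :
    deriv (fun e => f (t, e)) ε = fderiv ℝ f (t, ε) (0, 1) :=
  ((hf (t, ε)).hasFDerivAt.comp_hasDerivAt ε
    ((hasDerivAt_const ε t).prodMk (hasDerivAt_id ε))).deriv

theorem differentiable_fderiv_apply (hf : ContDiff ℝ 2 f) (v : ℝ × ℝ) :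
    Differentiable ℝ fun z => fderiv ℝ f z v :=
  ((hf.fderiv_right (m := 1) (by norm_num)).differentiable (by norm_num)).clm_apply
    (differentiable_const v)

theorem deriv_deriv_comm (hf : ContDiff ℝ 2 f) (t ε : ℝ) :
    deriv (fun e => deriv (fun τ => f (τ, e)) t) ε
      = deriv (fun τ => deriv (fun e => f (τ, e)) ε) t := by
  have hd : Differentiable ℝ f := hf.differentiable (by norm_num)
  have hd2 : DifferentiableAt ℝ (fderiv ℝ f) (t, ε) :=
    (hf.fderiv_right (m := 1) (by norm_num)).differentiable (by norm_num) _
  have hsymm : IsSymmSndFDerivAt ℝ f (t, ε) :=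
    hf.contDiffAt.isSymmSndFDerivAt (by simp)
  simp only [deriv_fst_eq_fderiv hd, deriv_snd_eq_fderiv hd]
  rw [deriv_snd_eq_fderiv (differentiable_fderiv_apply hf _),
    deriv_fst_eq_fderiv (differentiable_fderiv_apply hf _),
    fderiv_clm_apply hd2 (differentiableAt_const _),
    fderiv_clm_apply hd2 (differentiableAt_const _)]
  simpa using hsymm.eq (0, 1) (1, 0)

end MixedPartials

/-- **transpositional relations, eq. (2.20).**
For a C² two-parameter family `x(t,ε)` with
`∂ₜx = ξ₀(x,t) + η_p ξ_p(x)` and `∂_ε x = ω_p ξ_p(x)`, the relations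
`δη_p = dω_p/dt + C_{0q}^p ω_q + C_{qr}^p η_q ω_r` hold identically. -/
theorem transpositional_relations {m κ : ℕ}
    (ξ : Idx m κ → (Idx m κ → ℝ) → Idx m κ → ℝ)
    (ξ0 : (Idx m κ → ℝ) → ℝ → Idx m κ → ℝ)
    (C0 : Idx m κ → Idx m κ → (Idx m κ → ℝ) → ℝ → ℝ)
    (C : Idx m κ → Idx m κ → Idx m κ → (Idx m κ → ℝ) → ℝ → ℝ)
    (hξ : ∀ p, ContDiff ℝ 2 (ξ p))
    (hξ0 : ContDiff ℝ 2 (fun z : (Idx m κ → ℝ) × ℝ => ξ0 z.1 z.2))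
    (hind : ∀ x : Idx m κ → ℝ, LinearIndependent ℝ fun p => ξ p x)
    -- the structure relations `(X₀, X_p) = C_{0p}^q X_q`
    (hcomm0 : ∀ p (G : (Idx m κ → ℝ) → ℝ → ℝ),
      ContDiff ℝ 2 (fun z : (Idx m κ → ℝ) × ℝ => G z.1 z.2) →
      ∀ x t, X0 ξ0 (Xp ξ p G) x t - Xp ξ p (X0 ξ0 G) x t
        = ∑ q, C0 p q x t * Xp ξ q G x t)
    -- the structure relations `(X_p, X_q) = C_{pq}^r X_r`
    (hcomm : ∀ p q (G : (Idx m κ → ℝ) → ℝ → ℝ),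
      ContDiff ℝ 2 (fun z : (Idx m κ → ℝ) × ℝ => G z.1 z.2) →
      ∀ x t, Xp ξ p (Xp ξ q G) x t - Xp ξ q (Xp ξ p G) x t
        = ∑ r, C p q r x t * Xp ξ r G x t)
    -- the C² two-parameter family and its Poincaré parameters
    (x : ℝ × ℝ → Idx m κ → ℝ) (hx : ContDiff ℝ 2 x)
    (η ω : Idx m κ → ℝ → ℝ → ℝ)
    (hη : ∀ p t ε, deriv (fun τ => x (τ, ε) p) t
      = ξ0 (x (t, ε)) t p + ∑ q, η q t ε * ξ q (x (t, ε)) p)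
    (hω : ∀ p t ε, deriv (fun e => x (t, e) p) ε
      = ∑ q, ω q t ε * ξ q (x (t, ε)) p) :
    ∀ p t ε,
      deriv (fun e => η p t e) ε
        = deriv (fun τ => ω p τ ε) t
          + (∑ q, C0 q p (x (t, ε)) t * ω q t ε)
          + ∑ q, ∑ r, C q r p (x (t, ε)) t * η q t ε * ω r t ε := by
  intro p t ε
  have hxd : Differentiable ℝ x := hx.differentiable (by norm_num)
  have hxp : ∀ s, ContDiff ℝ 2 fun z => x z s := fun s => contDiff_pi.mp hx s
  have hξd : ∀ q s, Differentiable ℝ fun v => ξ q v s := fun q s =>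
    (contDiff_pi.mp (hξ q) s).differentiable (by norm_num)
  have hξ0d : ∀ s, Differentiable ℝ fun v => ξ0 v t s := fun s =>
    ((contDiff_pi.mp hξ0 s).differentiable (by norm_num)).comp
      (differentiable_id.prodMk (differentiable_const t))
  have hcoord : ∀ s : Idx m κ,
      ContDiff ℝ 2 fun z : (Idx m κ → ℝ) × ℝ => z.1 s := fun s => by fun_prop
  have hbr0 : ∀ q s, fderiv ℝ (fun v => ξ q v s) (x (t, ε)) (ξ0 (x (t, ε)) t)
      - fderiv ℝ (fun v => ξ0 v t s) (x (t, ε)) (ξ q (x (t, ε)))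
        = ∑ r, C0 q r (x (t, ε)) t * ξ r (x (t, ε)) s := by
    intro q s
    have h := hcomm0 q (fun v _ => v s) (hcoord s) (x (t, ε)) t
    simp only [Xp_coord, X0_coord] at h
    rw [X0_eq_fderiv ξ0 (hξd q s _), Xp_eq_fderiv ξ q (hξ0d s _)] at h
    simpa using h
  have hbr : ∀ q r s, fderiv ℝ (fun v => ξ r v s) (x (t, ε)) (ξ q (x (t, ε)))
      - fderiv ℝ (fun v => ξ q v s) (x (t, ε)) (ξ r (x (t, ε)))
        = ∑ l, C q r l (x (t, ε)) t * ξ l (x (t, ε)) s := by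
    intro q r s
    have h := hcomm q r (fun v _ => v s) (hcoord s) (x (t, ε)) t
    simp only [Xp_coord] at h
    rwa [Xp_eq_fderiv ξ q (hξd r s _), Xp_eq_fderiv ξ r (hξd q s _)] at h
  have hxε : HasDerivAt (fun e => x (t, e)) (∑ q, ω q t ε • ξ q (x (t, ε))) ε := by
    have hd : DifferentiableAt ℝ (fun e => x (t, e)) ε := by fun_prop
    rw [hasDerivAt_pi]
    intro s
    have h := (differentiableAt_pi.mp hd s).hasDerivAt
    rw [hω s t ε] at h
    simpa using h
  have hxt : HasDerivAt (fun τ => x (τ, ε))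
      (ξ0 (x (t, ε)) t + ∑ q, η q t ε • ξ q (x (t, ε))) t := by
    have hd : DifferentiableAt ℝ (fun τ => x (τ, ε)) t := by fun_prop
    rw [hasDerivAt_pi]
    intro s
    have h := (differentiableAt_pi.mp hd s).hasDerivAt
    rw [hη s t ε] at h
    simpa using h
  have hξε : ∀ q s, HasDerivAt (fun e => ξ q (x (t, e)) s)
      (fderiv ℝ (fun v => ξ q v s) (x (t, ε)) (∑ r, ω r t ε • ξ r (x (t, ε)))) ε := fun q s =>
    (hξd q s _).hasFDerivAt.comp_hasDerivAt ε hxε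
  have hξ0ε : ∀ s, HasDerivAt (fun e => ξ0 (x (t, e)) t s)
      (fderiv ℝ (fun v => ξ0 v t s) (x (t, ε)) (∑ r, ω r t ε • ξ r (x (t, ε)))) ε := fun s =>
    (hξ0d s _).hasFDerivAt.comp_hasDerivAt ε hxε
  have hξt : ∀ q s, HasDerivAt (fun τ => ξ q (x (τ, ε)) s)
      (fderiv ℝ (fun v => ξ q v s) (x (t, ε))
        (ξ0 (x (t, ε)) t + ∑ r, η r t ε • ξ r (x (t, ε)))) t := fun q s =>
    (hξd q s _).hasFDerivAt.comp_hasDerivAt t hxt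
  have hηd : ∀ q, DifferentiableAt ℝ (fun e => η q t e) ε := by
    refine differentiableAt_frame_coeff (F := fun q e => ξ q (x (t, e)))
      (b := fun s e => deriv (fun τ => x (τ, e) s) t - ξ0 (x (t, e)) t s)
      (c := fun q e => η q t e) (fun q s => (hξε q s).differentiableAt) (fun s => ?_)
      (fun e => hind _) (fun s e => by rw [hη s t e]; ring)
    refine DifferentiableAt.fun_sub ?_ (hξ0ε s).differentiableAt
    simp only [deriv_fst_eq_fderiv ((hxp s).differentiable (by norm_num))]
    exact (differentiable_fderiv_apply (hxp s) _ (t, ε)).comp ε (by fun_prop)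
  have hωd : ∀ q, DifferentiableAt ℝ (fun τ => ω q τ ε) t := by
    refine differentiableAt_frame_coeff (F := fun q τ => ξ q (x (τ, ε)))
      (b := fun s τ => deriv (fun e => x (τ, e) s) ε)
      (c := fun q τ => ω q τ ε) (fun q s => (hξt q s).differentiableAt) (fun s => ?_)
      (fun τ => hind _) (fun s τ => hω s τ ε)
    simp only [deriv_snd_eq_fderiv ((hxp s).differentiable (by norm_num))]
    exact DifferentiableAt.comp (f := fun τ => (τ, ε)) t
      (differentiable_fderiv_apply (hxp s) (0, 1) (t, ε)) (by fun_prop)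
  have key : ∀ s, ∑ q, (deriv (fun e => η q t e) ε
      - (deriv (fun τ => ω q τ ε) t + (∑ r, C0 r q (x (t, ε)) t * ω r t ε)
        + ∑ l, ∑ r, C l r q (x (t, ε)) t * η l t ε * ω r t ε)) * ξ q (x (t, ε)) s = 0 := by
    intro s
    have hmixed := deriv_deriv_comm (hxp s) t ε
    simp only [hη, hω] at hmixed
    rw [((hξ0ε s).fun_add (HasDerivAt.fun_sum fun q _ =>
        (hηd q).hasDerivAt.fun_mul (hξε q s))).deriv,
      (HasDerivAt.fun_sum fun q _ => (hωd q).hasDerivAt.fun_mul (hξt q s)).deriv] at hmixed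
    simp only [map_add, map_sum, map_smul, smul_eq_mul, Finset.sum_add_distrib, mul_add,
      Finset.mul_sum] at hmixed
    have h0 : ∑ q, (∑ r, C0 r q (x (t, ε)) t * ω r t ε) * ξ q (x (t, ε)) s
        = ∑ r, ω r t ε * fderiv ℝ (fun v => ξ r v s) (x (t, ε)) (ξ0 (x (t, ε)) t)
          - ∑ r, ω r t ε * fderiv ℝ (fun v => ξ0 v t s) (x (t, ε)) (ξ r (x (t, ε))) := by
      simp only [← Finset.sum_sub_distrib, ← mul_sub, hbr0, Finset.sum_mul, Finset.mul_sum]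
      rw [Finset.sum_comm]
      exact Finset.sum_congr rfl fun r _ => Finset.sum_congr rfl fun q _ => by ring
    have h1 : ∑ q, (∑ l, ∑ r, C l r q (x (t, ε)) t * η l t ε * ω r t ε) * ξ q (x (t, ε)) s
        = ∑ r, ∑ l, ω r t ε * (η l t ε
            * fderiv ℝ (fun v => ξ r v s) (x (t, ε)) (ξ l (x (t, ε))))
          - ∑ l, ∑ r, η l t ε * (ω r t ε
            * fderiv ℝ (fun v => ξ l v s) (x (t, ε)) (ξ r (x (t, ε)))) := by
      rw [Finset.sum_comm (f := fun r l => ω r t ε * (η l t ε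
            * fderiv ℝ (fun v => ξ r v s) (x (t, ε)) (ξ l (x (t, ε)))))]
      simp only [← Finset.sum_sub_distrib, Finset.sum_mul]
      rw [Finset.sum_comm]
      refine Finset.sum_congr rfl fun l _ => ?_
      rw [Finset.sum_comm]
      refine Finset.sum_congr rfl fun r _ => ?_
      rw [show ∀ a b c d : ℝ, a * (b * c) - b * (a * d) = a * b * (c - d) by intros; ring,
        hbr l r s, Finset.mul_sum]
      exact Finset.sum_congr rfl fun q _ => by ring
    simp only [sub_mul, add_mul, Finset.sum_sub_distrib, Finset.sum_add_distrib]
    rw [h0, h1]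
    linarith
  refine sub_eq_zero.mp (Fintype.linearIndependent_iff.mp (hind (x (t, ε))) (fun q =>
    deriv (fun e => η q t e) ε
      - (deriv (fun τ => ω q τ ε) t + (∑ r, C0 r q (x (t, ε)) t * ω r t ε)
        + ∑ l, ∑ r, C l r q (x (t, ε)) t * η l t ε * ω r t ε)) ?_ p)
  funext s
  simpa using key s


end NNH
end

section
/- Suppose along a C² motion t ↦ x(t) with real-displacement parameters η_p the constraints η_α(t) = φ_α(η_1(t),…,η_m(t), x(t), t) hold for all t, and let ω_p(t) be C¹ functions satisfying the Chetaev conditions ω_α = (∂φ_α/∂η_i) ω_i and the transpositional relations δη_p = ω̇_p + C_{0q}^p ω_q + C_{qr}^p η_q ω_r for all p = 1,…,n (δη_p denoting the synchronous variations of the η_p). Then for each α = m+1,…,n one has δη_α − δφ_α = (A_j^α)* ω_j, where δφ_α := (∂φ_α/∂η_j) δη_j + ω_p X_p φ_α. -/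
open scoped BigOperators

namespace NNH

variable {m κ : ℕ}

theorem differentiable_det {ι : Type*} [Fintype ι] [DecidableEq ι] {A : ℝ → Matrix ι ι ℝ}
    (hA : ∀ i j, Differentiable ℝ fun t => A t i j) :
    Differentiable ℝ fun t => (A t).det := by
  simp only [Matrix.det_apply']
  exact Differentiable.fun_sum fun σ _ =>
    (Differentiable.fun_finsetProd fun i _ => hA (σ i) i).const_mul _

/-- Cramer's rule: the solution of a linear system with differentiable coefficients and
nonvanishing determinant is differentiable. -/
theorem differentiable_of_mulVec_eq {ι : Type*} [Fintype ι] [DecidableEq ι]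
    {A : ℝ → Matrix ι ι ℝ} {b y : ℝ → ι → ℝ}
    (hA : ∀ i j, Differentiable ℝ fun t => A t i j)
    (hb : ∀ i, Differentiable ℝ fun t => b t i)
    (hdet : ∀ t, (A t).det ≠ 0) (h : ∀ t, (A t).mulVec (y t) = b t) (i : ι) :
    Differentiable ℝ fun t => y t i := by
  have key : (fun t => y t i) = fun t => ((A t).updateCol i (b t)).det / (A t).det := by
    funext t
    rw [eq_div_iff (hdet t), ← Matrix.cramer_apply, Matrix.cramer_eq_adjugate_mulVec, ← h t,
      Matrix.mulVec_mulVec, Matrix.adjugate_mul, Matrix.smul_mulVec, Matrix.one_mulVec,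
      Pi.smul_apply, smul_eq_mul, mul_comm]
  rw [key]
  refine (differentiable_det fun k l => ?_).div (differentiable_det hA) hdet
  simp only [Matrix.updateCol_apply]
  split_ifs
  · exact hb k
  · exact hA k l

/-- The Poincaré parameters of a `C²` motion are differentiable functions of time. -/
theorem differentiable_poincare_parameters
    {ξ : Idx m κ → (Idx m κ → ℝ) → Idx m κ → ℝ} {ξ0 : (Idx m κ → ℝ) → ℝ → Idx m κ → ℝ}
    (hξ : ∀ p, ContDiff ℝ 2 (ξ p))
    (hξ0 : ContDiff ℝ 2 (fun z : (Idx m κ → ℝ) × ℝ => ξ0 z.1 z.2))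
    (hind : ∀ x : Idx m κ → ℝ, LinearIndependent ℝ fun p => ξ p x)
    {xc : ℝ → Idx m κ → ℝ} (hxc : ContDiff ℝ 2 xc) {η : ℝ → Idx m κ → ℝ}
    (hη : ∀ p t, deriv (fun τ => xc τ p) t = ξ0 (xc t) t p + ∑ q, η t q * ξ q (xc t) p)
    (p : Idx m κ) : Differentiable ℝ fun t => η t p := by
  have hx : Differentiable ℝ xc := hxc.differentiable (by norm_num)
  refine differentiable_of_mulVec_eq (A := fun t => Matrix.of fun p q => ξ q (xc t) p)
    (b := fun t p => deriv (fun τ => xc τ p) t - ξ0 (xc t) t p) (fun i j => ?_) (fun i => ?_)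
    (fun t => ?_) (fun t => ?_) p
  · exact differentiable_pi.1 (((hξ j).differentiable (by norm_num)).comp hx) i
  · have h1 : ContDiff ℝ (1 + 1) fun τ => xc τ i := contDiff_pi.1 hxc i
    have h2 := (contDiff_succ_iff_deriv.1 h1).2.2
    exact (h2.differentiable (by norm_num)).sub
      (differentiable_pi.1 ((hξ0.differentiable (by norm_num)).comp (hx.prodMk differentiable_id)) i)
  · have h : LinearIndependent ℝ (Matrix.of fun p q => ξ q (xc t) p).col := hind (xc t)
    rw [Matrix.linearIndependent_cols_iff_isUnit, Matrix.isUnit_iff_isUnit_det] at h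
    exact h.ne_zero
  · funext p
    simp [Matrix.mulVec, dotProduct, hη p t, mul_comm]

theorem pd_eq_fderiv_s3 {ι : Type*} [Fintype ι] [DecidableEq ι] {E : Type*} [NormedAddCommGroup E]
    [NormedSpace ℝ E] {F : (ι → ℝ) × E → ℝ} (hF : Differentiable ℝ F) (j : ι) (v : ι → ℝ) (e : E) :
    pd (fun w => F (w, e)) j v = fderiv ℝ F (v, e) (Pi.single j 1, 0) := by
  have h := (hF (Function.update v j (v j), e)).hasFDerivAt.comp_hasDerivAt (v j)
    ((hasDerivAt_update v j (v j)).prodMk (hasDerivAt_const (v j) e))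
  rw [Function.update_eq_self] at h
  exact h.deriv

theorem differentiable_dphi {φ : Fin κ → (Fin m → ℝ) → (Idx m κ → ℝ) → ℝ → ℝ} {α : Fin κ}
    (hφ : ContDiff ℝ 2 (fun z : (Fin m → ℝ) × (Idx m κ → ℝ) × ℝ => φ α z.1 z.2.1 z.2.2))
    {v : ℝ → Fin m → ℝ} {x : ℝ → Idx m κ → ℝ} (hv : Differentiable ℝ v)
    (hx : Differentiable ℝ x) (j : Fin m) :
    Differentiable ℝ fun t => dphi φ α j (v t) (x t) t := by
  have key : (fun t => dphi φ α j (v t) (x t) t) = fun t =>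
      fderiv ℝ (fun z : (Fin m → ℝ) × (Idx m κ → ℝ) × ℝ => φ α z.1 z.2.1 z.2.2) (v t, x t, t)
        (Pi.single j 1, 0) :=
    funext fun t => pd_eq_fderiv_s3 (hφ.differentiable (by norm_num)) j (v t) (x t, t)
  rw [key]
  have h : ContDiff ℝ 1
      (fderiv ℝ (fun z : (Fin m → ℝ) × (Idx m κ → ℝ) × ℝ => φ α z.1 z.2.1 z.2.2)) :=
    hφ.fderiv_right (by norm_num)
  exact ((h.differentiable (by norm_num)).comp
    (hv.prodMk (hx.prodMk differentiable_id))).clm_apply (differentiable_const _)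

/-- Contracting with an admissible virtual displacement `w` reduces to the independent indices. -/
theorem sum_reduced_mul {D : Fin κ → Fin m → ℝ} {w : Idx m κ → ℝ}
    (hw : ∀ β, w (.inr β) = ∑ i, D β i * w (.inl i)) (f : Idx m κ → ℝ) :
    ∑ j, (f (.inl j) + ∑ β, f (.inr β) * D β j) * w (.inl j) = ∑ q, f q * w q := by
  simp only [Fintype.sum_sum_type, add_mul, Finset.sum_add_distrib, hw, Finset.sum_mul,
    Finset.mul_sum]
  rw [Finset.sum_comm]
  simp only [mul_assoc]

/-- **Statement 3 (eq. (3.9)): `δη_α − δφ_α = (A_j^α)* ω_j`** for synchronous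
variations satisfying the Chetaev conditions and the transpositional
relations along a constrained motion. -/
theorem delta_constraint_Astar {m κ : ℕ}
    (ξ : Idx m κ → (Idx m κ → ℝ) → Idx m κ → ℝ)
    (ξ0 : (Idx m κ → ℝ) → ℝ → Idx m κ → ℝ)
    (C0 : Idx m κ → Idx m κ → (Idx m κ → ℝ) → ℝ → ℝ)
    (C : Idx m κ → Idx m κ → Idx m κ → (Idx m κ → ℝ) → ℝ → ℝ)
    (φ : Fin κ → (Fin m → ℝ) → (Idx m κ → ℝ) → ℝ → ℝ)
    (hξ : ∀ p, ContDiff ℝ 2 (ξ p))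
    (hξ0 : ContDiff ℝ 2 (fun z : (Idx m κ → ℝ) × ℝ => ξ0 z.1 z.2))
    (hind : ∀ x : Idx m κ → ℝ, LinearIndependent ℝ fun p => ξ p x)
    (hφ : ∀ α, ContDiff ℝ 2
      (fun z : (Fin m → ℝ) × (Idx m κ → ℝ) × ℝ => φ α z.1 z.2.1 z.2.2))
    (hcomm0 : ∀ p (G : (Idx m κ → ℝ) → ℝ → ℝ),
      ContDiff ℝ 2 (fun z : (Idx m κ → ℝ) × ℝ => G z.1 z.2) →
      ∀ x t, X0 ξ0 (Xp ξ p G) x t - Xp ξ p (X0 ξ0 G) x t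
        = ∑ q, C0 p q x t * Xp ξ q G x t)
    (hcomm : ∀ p q (G : (Idx m κ → ℝ) → ℝ → ℝ),
      ContDiff ℝ 2 (fun z : (Idx m κ → ℝ) × ℝ => G z.1 z.2) →
      ∀ x t, Xp ξ p (Xp ξ q G) x t - Xp ξ q (Xp ξ p G) x t
        = ∑ r, C p q r x t * Xp ξ r G x t)
    -- the C² motion and its Poincaré parameters of real displacement
    (xc : ℝ → Idx m κ → ℝ) (hxc : ContDiff ℝ 2 xc)
    (η : ℝ → Idx m κ → ℝ)
    (hη : ∀ p t, deriv (fun τ => xc τ p) t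
      = ξ0 (xc t) t p + ∑ q, η t q * ξ q (xc t) p)
    -- the nonlinear nonholonomic constraints `η_α = φ_α(η_i, x, t)`
    (hcon : ∀ α t, η t (.inr α) = φ α (vmOf η t) (xc t) t)
    -- C¹ virtual-displacement parameters satisfying the Chetaev conditions
    (ω : ℝ → Idx m κ → ℝ) (hωC1 : ContDiff ℝ 1 ω)
    (hchetaev : ∀ α t,
      ω t (.inr α) = ∑ i, dphi φ α i (vmOf η t) (xc t) t * ω t (.inl i))
    -- synchronous variations of the η's, given by the transpositional relations
    (δη : ℝ → Idx m κ → ℝ)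
    (htrans : ∀ p t, δη t p
      = deriv (fun τ => ω τ p) t
        + (∑ q, C0 q p (xc t) t * ω t q)
        + ∑ q, ∑ r, C q r p (xc t) t * η t q * ω t r) :
    ∀ α t,
      δη t (.inr α)
        - ((∑ j, dphi φ α j (vmOf η t) (xc t) t * δη t (.inl j))
            + ∑ p, ω t p * Xp ξ p (fun x' t' => φ α (vmOf η t) x' t') (xc t) t)
      = ∑ j, Astar ξ C0 C φ xc (vmOf η) j α t * ω t (.inl j) := by
  intro α t
  have hηd := differentiable_poincare_parameters hξ hξ0 hind hxc hη
  have hD := fun j => differentiable_dphi (hφ α) (v := vmOf η)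
    (differentiable_pi.2 fun i => hηd (.inl i)) (hxc.differentiable (by norm_num)) j
  have hωd : ∀ p, Differentiable ℝ fun τ => ω τ p :=
    differentiable_pi.1 (hωC1.differentiable (by norm_num))
  have hωα : deriv (fun τ => ω τ (.inr α)) t
      = ∑ i, (deriv (fun τ => dphi φ α i (vmOf η τ) (xc τ) τ) t * ω t (.inl i)
        + dphi φ α i (vmOf η t) (xc t) t * deriv (fun τ => ω τ (.inl i)) t) := by
    simp only [hchetaev α]
    exact (HasDerivAt.fun_sum fun i _ =>
      ((hD i) t).hasDerivAt.mul ((hωd (.inl i)) t).hasDerivAt).deriv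
  have hK0 : ∀ s, ∑ j, K0 C0 φ j s (vmOf η t) (xc t) t * ω t (.inl j)
      = ∑ q, C0 q s (xc t) t * ω t q := fun s =>
    sum_reduced_mul (fun β => hchetaev β t) fun q => C0 q s (xc t) t
  have hX : ∑ j, Xstar ξ φ j (fun x' t' => φ α (vmOf η t) x' t') (vmOf η t) (xc t) t * ω t (.inl j)
      = ∑ p, ω t p * Xp ξ p (fun x' t' => φ α (vmOf η t) x' t') (xc t) t := by
    simpa only [Xstar, mul_comm] using sum_reduced_mul (fun β => hchetaev β t)
      fun p => Xp ξ p (fun x' t' => φ α (vmOf η t) x' t') (xc t) t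
  have hK : ∀ s, ∑ j, (∑ i, Kq C φ (.inl i) j s (vmOf η t) (xc t) t * vmOf η t i
        + ∑ β, Kq C φ (.inr β) j s (vmOf η t) (xc t) t * φ β (vmOf η t) (xc t) t) * ω t (.inl j)
      = ∑ q, ∑ r, C q r s (xc t) t * η t q * ω t r := fun s => by
    have hq : ∀ q, ∑ j, Kq C φ q j s (vmOf η t) (xc t) t * ω t (.inl j)
        = ∑ r, C q r s (xc t) t * ω t r := fun q =>
      sum_reduced_mul (fun β => hchetaev β t) fun r => C q r s (xc t) t
    have hj : ∀ j, ∑ i, Kq C φ (.inl i) j s (vmOf η t) (xc t) t * vmOf η t i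
        + ∑ β, Kq C φ (.inr β) j s (vmOf η t) (xc t) t * φ β (vmOf η t) (xc t) t
        = ∑ q, Kq C φ q j s (vmOf η t) (xc t) t * η t q := fun j => by
      simp only [Fintype.sum_sum_type, hcon, vmOf]
    simp only [hj, Finset.sum_mul]
    rw [Finset.sum_comm]
    refine Finset.sum_congr rfl fun q _ => ?_
    simp only [mul_right_comm _ (η t q), ← Finset.sum_mul, hq q]
  set B : Idx m κ → Fin m → ℝ := fun s j => K0 C0 φ j s (vmOf η t) (xc t) t
    + ∑ i, Kq C φ (.inl i) j s (vmOf η t) (xc t) t * vmOf η t i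
    + ∑ β, Kq C φ (.inr β) j s (vmOf η t) (xc t) t * φ β (vmOf η t) (xc t) t with hB
  have hδ : ∀ s, δη t s = deriv (fun τ => ω τ s) t + ∑ j, B s j * ω t (.inl j) := fun s => by
    rw [htrans s t, ← hK0, ← hK, add_assoc, ← Finset.sum_add_distrib]
    congr 1
    exact Finset.sum_congr rfl fun j _ => by ring
  have hA : ∀ j, Astar ξ C0 C φ xc (vmOf η) j α t
      = deriv (fun τ => dphi φ α j (vmOf η τ) (xc τ) τ) t
        - Xstar ξ φ j (fun x' t' => φ α (vmOf η t) x' t') (vmOf η t) (xc t) t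
        + B (.inr α) j - ∑ k, B (.inl k) j * dphi φ α k (vmOf η t) (xc t) t := fun j => by
    simp only [Astar, hB]
    ring
  have hswap : ∑ j, dphi φ α j (vmOf η t) (xc t) t * ∑ l, B (.inl j) l * ω t (.inl l)
      = ∑ l, (∑ k, B (.inl k) l * dphi φ α k (vmOf η t) (xc t) t) * ω t (.inl l) := by
    simp only [Finset.mul_sum, Finset.sum_mul]
    rw [Finset.sum_comm]
    exact Finset.sum_congr rfl fun l _ => Finset.sum_congr rfl fun k _ => by ring
  rw [← hX, hδ, hωα]
  simp only [hδ, hA, mul_add, sub_mul, add_mul, Finset.sum_add_distrib, Finset.sum_sub_distrib,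
    hswap]
  ring

end NNH
end

section
/- Let t ↦ x(t) be a C² motion with real-displacement parameters η_p satisfying the constraints η_α = φ_α(η_i, x, t). Then the following are equivalent: (i) at every time t the d'Alembert–Lagrange–Poincaré equation [ d/dt(∂L/∂η_p) − C_{0p}^q ∂L/∂η_q − C_{qp}^r η_q ∂L/∂η_r − X_p L ] ω_p = 0 holds for every ω ∈ ℝⁿ satisfying the Chetaev conditions ω_α = (∂φ_α/∂η_i) ω_i; (ii) the motion satisfies the multiplier-free Poincaré equations of motion d/dt(∂L*/∂η_j) − (K_{0j}^k + K_{qj}^k η_q) ∂L*/∂η_k − X*_j L* − (A_j^α)* (∂L/∂η_α)* = 0 for j = 1,…,m. -/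
open scoped BigOperators

namespace NNH

variable {m κ : ℕ}

/-- A coordinate derivative is the Fréchet derivative in a basis direction. -/
theorem pd_of_hasFDerivAt {ι : Type*} [Fintype ι] [DecidableEq ι] {f : (ι → ℝ) → ℝ}
    {f' : (ι → ℝ) →L[ℝ] ℝ} {v : ι → ℝ} (h : HasFDerivAt f f' v) (i : ι) :
    pd f i v = f' (Pi.single i 1) := by
  have hu := hasDerivAt_update (𝕜 := ℝ) v i (v i)
  rw [← Function.update_eq_self i v] at h
  have h2 := h.comp_hasDerivAt (v i) hu
  exact h2.deriv

section Joint

variable {ι ι' : Type*} [Fintype ι] [Fintype ι']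
  {f : (ι → ℝ) → (ι' → ℝ) → ℝ → ℝ}

theorem pd_fst_eq_fderiv [DecidableEq ι] {v : ι → ℝ} {x : ι' → ℝ} {t : ℝ}
    (hf : Differentiable ℝ fun z : (ι → ℝ) × (ι' → ℝ) × ℝ => f z.1 z.2.1 z.2.2) (i : ι) :
    pd (fun w => f w x t) i v
      = fderiv ℝ (fun z : (ι → ℝ) × (ι' → ℝ) × ℝ => f z.1 z.2.1 z.2.2) (v, x, t)
          (Pi.single i 1, 0, 0) := by
  have h1 : HasFDerivAt (fun w : ι → ℝ => (w, x, t))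
      (ContinuousLinearMap.inl ℝ (ι → ℝ) ((ι' → ℝ) × ℝ)) v := hasFDerivAt_prodMk_left v (x, t)
  have h := (hf (v, x, t)).hasFDerivAt.comp v h1
  rw [show (fun w => f w x t)
    = (fun z : (ι → ℝ) × (ι' → ℝ) × ℝ => f z.1 z.2.1 z.2.2) ∘ fun w => (w, x, t) from rfl,
    pd_of_hasFDerivAt h i]
  rfl

theorem pd_snd_eq_fderiv [DecidableEq ι'] {v : ι → ℝ} {x : ι' → ℝ} {t : ℝ}
    (hf : Differentiable ℝ fun z : (ι → ℝ) × (ι' → ℝ) × ℝ => f z.1 z.2.1 z.2.2) (i : ι') :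
    pd (fun y => f v y t) i x
      = fderiv ℝ (fun z : (ι → ℝ) × (ι' → ℝ) × ℝ => f z.1 z.2.1 z.2.2) (v, x, t)
          (0, Pi.single i 1, 0) := by
  have h1 : HasFDerivAt (fun y : ι' → ℝ => (v, y, t))
      ((ContinuousLinearMap.inr ℝ (ι → ℝ) ((ι' → ℝ) × ℝ)).comp
        (ContinuousLinearMap.inl ℝ (ι' → ℝ) ℝ)) x :=
    (hasFDerivAt_prodMk_right v (x, t)).comp x (hasFDerivAt_prodMk_left x t)
  have h := (hf (v, x, t)).hasFDerivAt.comp x h1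
  rw [show (fun y => f v y t)
    = (fun z : (ι → ℝ) × (ι' → ℝ) × ℝ => f z.1 z.2.1 z.2.2) ∘ fun y => (v, y, t) from rfl,
    pd_of_hasFDerivAt h i]
  rfl

/-- The coordinate derivatives in the first argument of a `C²` function are differentiable
along differentiable curves. -/
theorem differentiable_pd_fst_along [DecidableEq ι]
    (hf : ContDiff ℝ 2 fun z : (ι → ℝ) × (ι' → ℝ) × ℝ => f z.1 z.2.1 z.2.2) (i : ι)
    {v : ℝ → ι → ℝ} {x : ℝ → ι' → ℝ} (hv : Differentiable ℝ v) (hx : Differentiable ℝ x) :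
    Differentiable ℝ fun τ => pd (fun w => f w (x τ) τ) i (v τ) := by
  have hd := hf.differentiable two_ne_zero
  simp only [pd_fst_eq_fderiv hd]
  have h1 : ContDiff ℝ 1
      (fderiv ℝ fun z : (ι → ℝ) × (ι' → ℝ) × ℝ => f z.1 z.2.1 z.2.2) :=
    hf.fderiv_right (by norm_num)
  have h2 : Differentiable ℝ fun τ : ℝ => (v τ, x τ, τ) := by fun_prop
  exact ((h1.differentiable one_ne_zero).comp h2).clm_apply (differentiable_const _)

/-- Chain rule, in coordinates, at fixed time. -/
theorem hasDerivAt_comp_coords [DecidableEq ι] [DecidableEq ι']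
    (hf : Differentiable ℝ fun z : (ι → ℝ) × (ι' → ℝ) × ℝ => f z.1 z.2.1 z.2.2)
    {c : ℝ → ι → ℝ} {c' : ι → ℝ} {y : ℝ → ι' → ℝ} {y' : ι' → ℝ} {s : ℝ} (t : ℝ)
    (hc : HasDerivAt c c' s) (hy : HasDerivAt y y' s) :
    HasDerivAt (fun r => f (c r) (y r) t)
      (∑ p, pd (fun w => f w (y s) t) p (c s) * c' p
        + ∑ q, pd (fun x => f (c s) x t) q (y s) * y' q) s := by
  have h := (hf (c s, y s, t)).hasFDerivAt.comp_hasDerivAt s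
    (hc.prodMk (hy.prodMk (hasDerivAt_const s t)))
  refine h.congr_deriv ?_
  simp only [pd_fst_eq_fderiv hf, pd_snd_eq_fderiv hf]
  set D := fderiv ℝ (fun z : (ι → ℝ) × (ι' → ℝ) × ℝ => f z.1 z.2.1 z.2.2) (c s, y s, t)
  have e1 : ((c', y', 0) : (ι → ℝ) × (ι' → ℝ) × ℝ)
      = ∑ p, c' p • ((Pi.single p 1, 0, 0) : (ι → ℝ) × (ι' → ℝ) × ℝ)
        + ∑ q, y' q • ((0, Pi.single q 1, 0) : (ι → ℝ) × (ι' → ℝ) × ℝ) := by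
    refine Prod.ext ?_ (Prod.ext ?_ ?_)
    · simp [Prod.fst_sum, ← pi_eq_sum_univ' c']
    · simp [Prod.fst_sum, Prod.snd_sum, ← pi_eq_sum_univ' y']
    · simp [Prod.snd_sum]
  rw [e1]
  simp only [map_add, map_sum, map_smul, smul_eq_mul]
  congr 1 <;> exact Finset.sum_congr rfl fun _ _ => mul_comm _ _

end Joint

variable {φ : Fin κ → (Fin m → ℝ) → (Idx m κ → ℝ) → ℝ → ℝ}
  {L : (Idx m κ → ℝ) → (Idx m κ → ℝ) → ℝ → ℝ}

/-- `∂L*/∂η_j = ∂L/∂η_j + ∂L/∂η_α ∂φ_α/∂η_j`. -/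
theorem pLstar_eq
    (hφ : ∀ α, Differentiable ℝ
      (fun z : (Fin m → ℝ) × (Idx m κ → ℝ) × ℝ => φ α z.1 z.2.1 z.2.2))
    (hL : Differentiable ℝ
      (fun z : (Idx m κ → ℝ) × (Idx m κ → ℝ) × ℝ => L z.1 z.2.1 z.2.2))
    (j : Fin m) (v : Fin m → ℝ) (x : Idx m κ → ℝ) (t : ℝ) :
    pLstar L φ j v x t = pEta L (.inl j) (etaExt φ v x t) x t
      + ∑ α, pEta L (.inr α) (etaExt φ v x t) x t * dphi φ α j v x t := by
  have hu := hasDerivAt_update (𝕜 := ℝ) v j (v j)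
  have hc : HasDerivAt (fun s => etaExt φ (Function.update v j s) x t)
      (Sum.elim (Pi.single j 1) fun α => dphi φ α j v x t) (v j) := by
    rw [hasDerivAt_pi]
    rintro (i | α)
    · exact (hasDerivAt_pi.1 hu) i
    · have h := hasDerivAt_comp_coords (hφ α) t hu (hasDerivAt_const (v j) x)
      simpa [dphi, etaExt, Pi.single_apply] using h
  have h := hasDerivAt_comp_coords hL t hc (hasDerivAt_const (v j) x)
  change deriv (fun s => L (etaExt φ (Function.update v j s) x t) x t) (v j) = _
  rw [h.deriv]
  simp [Fintype.sum_sum_type, Pi.single_apply, pEta]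

/-- `∂L*/∂x_q = ∂L/∂x_q + ∂L/∂η_α ∂φ_α/∂x_q`. -/
theorem pd_Lstar_eq
    (hφ : ∀ α, Differentiable ℝ
      (fun z : (Fin m → ℝ) × (Idx m κ → ℝ) × ℝ => φ α z.1 z.2.1 z.2.2))
    (hL : Differentiable ℝ
      (fun z : (Idx m κ → ℝ) × (Idx m κ → ℝ) × ℝ => L z.1 z.2.1 z.2.2))
    (q : Idx m κ) (v : Fin m → ℝ) (x : Idx m κ → ℝ) (t : ℝ) :
    pd (fun y => Lstar L φ v y t) q x = pd (fun y => L (etaExt φ v x t) y t) q x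
      + ∑ α, pEta L (.inr α) (etaExt φ v x t) x t * pd (fun y => φ α v y t) q x := by
  have hu := hasDerivAt_update (𝕜 := ℝ) x q (x q)
  have hc : HasDerivAt (fun s => etaExt φ v (Function.update x q s) t)
      (Sum.elim 0 fun α => pd (fun y => φ α v y t) q x) (x q) := by
    rw [hasDerivAt_pi]
    rintro (i | α)
    · exact hasDerivAt_const _ _
    · have h := hasDerivAt_comp_coords (hφ α) t (hasDerivAt_const (x q) v) hu
      simpa [etaExt, Pi.single_apply] using h
  have h := hasDerivAt_comp_coords hL t hc hu
  change deriv (fun s => L (etaExt φ v (Function.update x q s) t) (Function.update x q s) t) (x q) = _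
  rw [h.deriv, add_comm]
  simp [Fintype.sum_sum_type, Pi.single_apply, pEta]

theorem Xp_Lstar_eq (ξ : Idx m κ → (Idx m κ → ℝ) → Idx m κ → ℝ)
    (hφ : ∀ α, Differentiable ℝ
      (fun z : (Fin m → ℝ) × (Idx m κ → ℝ) × ℝ => φ α z.1 z.2.1 z.2.2))
    (hL : Differentiable ℝ
      (fun z : (Idx m κ → ℝ) × (Idx m κ → ℝ) × ℝ => L z.1 z.2.1 z.2.2))
    (p : Idx m κ) (v : Fin m → ℝ) (x : Idx m κ → ℝ) (t : ℝ) :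
    Xp ξ p (fun y s => Lstar L φ v y s) x t
      = Xp ξ p (fun y s => L (etaExt φ v x t) y s) x t
      + ∑ α, pEta L (.inr α) (etaExt φ v x t) x t * Xp ξ p (fun y s => φ α v y s) x t := by
  simp only [Xp, pd_Lstar_eq hφ hL, mul_add, Finset.sum_add_distrib, Finset.mul_sum]
  rw [Finset.sum_comm]
  congr 1
  exact Finset.sum_congr rfl fun _ _ => Finset.sum_congr rfl fun _ _ => by ring

/-- The coefficients of a differentiable vector with respect to a differentiable moving basis
are differentiable. -/
theorem differentiable_coeff_of_linearIndependent {ι : Type*} [Fintype ι] [DecidableEq ι]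
    {b : ℝ → ι → ι → ℝ} {u c : ℝ → ι → ℝ} (hb : ∀ q p, Differentiable ℝ fun t => b t q p)
    (hu : ∀ p, Differentiable ℝ fun t => u t p) (hind : ∀ t, LinearIndependent ℝ (b t))
    (h : ∀ t p, u t p = ∑ q, c t q * b t q p) : Differentiable ℝ c := by
  have hunit : ∀ t, IsUnit (Matrix.of (b t)) := fun t =>
    Matrix.linearIndependent_rows_iff_isUnit.1 (hind t)
  have hdet0 : ∀ t, (Matrix.of (b t)).det ≠ 0 := fun t =>
    ((Matrix.isUnit_iff_isUnit_det _).1 (hunit t)).ne_zero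
  have hdet : ∀ M : ℝ → Matrix ι ι ℝ, (∀ q p, Differentiable ℝ fun t => M t q p) →
      Differentiable ℝ fun t => (M t).det := by
    intro M hM
    simp only [Matrix.det_apply']
    fun_prop
  have hadj : ∀ q p, Differentiable ℝ fun t => (Matrix.of (b t)).adjugate q p := by
    intro q p
    simp only [Matrix.adjugate_apply]
    refine hdet _ fun r s => ?_
    by_cases hr : r = p
    · subst hr
      simp
    · simpa [Matrix.updateRow_ne hr] using hb r s
  have hc : ∀ t q, c t q
      = ((Matrix.of (b t)).det)⁻¹ * ∑ p, u t p * (Matrix.of (b t)).adjugate p q := by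
    intro t q
    have h1 : u t = Matrix.vecMul (c t) (Matrix.of (b t)) := by
      funext p
      simp [Matrix.vecMul, dotProduct, h t p]
    have h2 : Matrix.vecMul (u t) (Matrix.of (b t)).adjugate
        = (Matrix.of (b t)).det • c t := by
      rw [h1, Matrix.vecMul_vecMul, Matrix.mul_adjugate, Matrix.vecMul_smul, Matrix.vecMul_one]
    have h3 := congrFun h2 q
    simp only [Matrix.vecMul, dotProduct, Pi.smul_apply, smul_eq_mul] at h3
    rw [h3, inv_mul_cancel_left₀ (hdet0 t)]
  rw [differentiable_pi]
  intro q
  simp only [hc]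
  have hd := hdet (fun t => Matrix.of (b t)) hb
  exact (hd.inv hdet0).mul (Differentiable.fun_sum fun p _ => (hu p).mul (hadj p q))

/-- A linear form vanishes on all admissible displacements iff its reduced coefficients vanish. -/
theorem sum_mul_eq_zero_iff_of_chetaev (E : Idx m κ → ℝ) (d : Fin κ → Fin m → ℝ) :
    (∀ ω : Idx m κ → ℝ, (∀ α, ω (.inr α) = ∑ i, d α i * ω (.inl i)) → ∑ p, E p * ω p = 0)
      ↔ ∀ j, E (.inl j) + ∑ α, E (.inr α) * d α j = 0 := by
  constructor
  · intro h j
    have := h (Sum.elim (Pi.single j 1) fun α => d α j) (by simp [Pi.single_apply])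
    simpa [Fintype.sum_sum_type, Pi.single_apply] using this
  · intro h ω hω
    have key : ∑ p, E p * ω p
        = ∑ j, (E (.inl j) + ∑ α, E (.inr α) * d α j) * ω (.inl j) := by
      simp only [Fintype.sum_sum_type, hω, add_mul, Finset.sum_add_distrib, Finset.sum_mul,
        Finset.mul_sum]
      rw [Finset.sum_comm (s := (Finset.univ : Finset (Fin κ)))]
      simp only [mul_assoc]
    simp [key, h]

/-- Algebraic core: contraction with `L_q` of a form whose components are split by means of
`l_k = L_k + L_α d_{αk}`. -/
theorem sum_split_reduced (K lam : Idx m κ → ℝ) (d : Fin κ → Fin m → ℝ) :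
    ∑ s, K s * lam s = ∑ k, K (.inl k) * (lam (.inl k) + ∑ α, lam (.inr α) * d α k)
      + ∑ α, (K (.inr α) - ∑ k, K (.inl k) * d α k) * lam (.inr α) := by
  simp only [Fintype.sum_sum_type, mul_add, sub_mul, Finset.sum_add_distrib,
    Finset.sum_sub_distrib, Finset.mul_sum, Finset.sum_mul]
  rw [Finset.sum_comm (s := (Finset.univ : Finset (Fin κ)))]
  have : ∀ a b : ℝ, ∀ c e : ℝ, c = e → a + b = a + c + (b - e) := by intros; subst_vars; ring
  refine this _ _ _ _ ?_
  exact Finset.sum_congr rfl fun _ _ => Finset.sum_congr rfl fun _ _ => by ring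

/-- **equations (4.1) ⟺ (4.6).** The d'Alembert–Lagrange–Poincaré
principle for all Chetaev-admissible virtual displacements is equivalent to the
multiplier-free Poincaré equations of motion. -/
theorem dAlembert_iff_multiplier_free {m κ : ℕ}
    (ξ : Idx m κ → (Idx m κ → ℝ) → Idx m κ → ℝ)
    (ξ0 : (Idx m κ → ℝ) → ℝ → Idx m κ → ℝ)
    (C0 : Idx m κ → Idx m κ → (Idx m κ → ℝ) → ℝ → ℝ)
    (C : Idx m κ → Idx m κ → Idx m κ → (Idx m κ → ℝ) → ℝ → ℝ)
    (φ : Fin κ → (Fin m → ℝ) → (Idx m κ → ℝ) → ℝ → ℝ)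
    (L : (Idx m κ → ℝ) → (Idx m κ → ℝ) → ℝ → ℝ)
    (hξ : ∀ p, ContDiff ℝ 2 (ξ p))
    (hξ0 : ContDiff ℝ 2 (fun z : (Idx m κ → ℝ) × ℝ => ξ0 z.1 z.2))
    (hind : ∀ x : Idx m κ → ℝ, LinearIndependent ℝ fun p => ξ p x)
    (hφ : ∀ α, ContDiff ℝ 2
      (fun z : (Fin m → ℝ) × (Idx m κ → ℝ) × ℝ => φ α z.1 z.2.1 z.2.2))
    (hL : ContDiff ℝ 2
      (fun z : (Idx m κ → ℝ) × (Idx m κ → ℝ) × ℝ => L z.1 z.2.1 z.2.2))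
    (hcomm0 : ∀ p (G : (Idx m κ → ℝ) → ℝ → ℝ),
      ContDiff ℝ 2 (fun z : (Idx m κ → ℝ) × ℝ => G z.1 z.2) →
      ∀ x t, X0 ξ0 (Xp ξ p G) x t - Xp ξ p (X0 ξ0 G) x t
        = ∑ q, C0 p q x t * Xp ξ q G x t)
    (hcomm : ∀ p q (G : (Idx m κ → ℝ) → ℝ → ℝ),
      ContDiff ℝ 2 (fun z : (Idx m κ → ℝ) × ℝ => G z.1 z.2) →
      ∀ x t, Xp ξ p (Xp ξ q G) x t - Xp ξ q (Xp ξ p G) x t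
        = ∑ r, C p q r x t * Xp ξ r G x t)
    -- the C² motion, its Poincaré parameters, and the constraints
    (xc : ℝ → Idx m κ → ℝ) (hxc : ContDiff ℝ 2 xc)
    (η : ℝ → Idx m κ → ℝ)
    (hη : ∀ p t, deriv (fun τ => xc τ p) t
      = ξ0 (xc t) t p + ∑ q, η t q * ξ q (xc t) p)
    (hcon : ∀ α t, η t (.inr α) = φ α (vmOf η t) (xc t) t) :
    -- (i) the d'Alembert–Lagrange–Poincaré equation holds for every
    --     virtual displacement `ω` satisfying the Chetaev conditions
    (∀ t (ω : Idx m κ → ℝ),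
        (∀ α, ω (.inr α) = ∑ i, dphi φ α i (vmOf η t) (xc t) t * ω (.inl i)) →
        (∑ p,
          (deriv (fun τ => pEta L p (η τ) (xc τ) τ) t
            - (∑ q, C0 p q (xc t) t * pEta L q (η t) (xc t) t)
            - (∑ q, ∑ r, C q p r (xc t) t * η t q * pEta L r (η t) (xc t) t)
            - Xp ξ p (fun x' t' => L (η t) x' t') (xc t) t) * ω p) = 0)
    ↔
    -- (ii) the multiplier-free Poincaré equations of motion hold
    (∀ t (j : Fin m), PoincareLHS ξ C0 C φ L xc η j t = 0) := by
  have hφ1 := fun α => (hφ α).differentiable two_ne_zero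
  have hL1 := hL.differentiable two_ne_zero
  have hxd : Differentiable ℝ xc := hxc.differentiable two_ne_zero
  have hηd : Differentiable ℝ η := by
    refine differentiable_coeff_of_linearIndependent (b := fun t q p => ξ q (xc t) p)
      (u := fun t p => deriv (fun τ => xc τ p) t - ξ0 (xc t) t p) ?_ ?_ (fun t => hind (xc t)) ?_
    · intro q p
      exact differentiable_pi.1 (((hξ q).differentiable two_ne_zero).comp hxd) p
    · intro p
      have h1 : ContDiff ℝ 2 fun τ => xc τ p := contDiff_pi.1 hxc p
      have h2 : Differentiable ℝ fun t => ξ0 (xc t) t :=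
        (hξ0.differentiable two_ne_zero).comp (hxd.prodMk differentiable_id)
      have h3 : ContDiff ℝ 1 (deriv fun τ => xc τ p) :=
        ((contDiff_succ_iff_deriv (n := 1)).1 (by simpa [one_add_one_eq_two] using h1)).2.2
      exact (h3.differentiable one_ne_zero).sub (differentiable_pi.1 h2 p)
    · intro t p
      rw [hη p t]
      ring
  have hvd : Differentiable ℝ (vmOf η) :=
    differentiable_pi.2 fun i => differentiable_pi.1 hηd (.inl i)
  have hext : ∀ t, etaExt φ (vmOf η t) (xc t) t = η t := by
    intro t
    funext p
    rcases p with i | α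
    · rfl
    · exact (hcon α t).symm
  have hLd : ∀ p, Differentiable ℝ fun τ => pEta L p (η τ) (xc τ) τ := fun p =>
    differentiable_pd_fst_along hL p hηd hxd
  have hdd : ∀ α j, Differentiable ℝ fun τ => dphi φ α j (vmOf η τ) (xc τ) τ := fun α j =>
    differentiable_pd_fst_along (hφ α) j hvd hxd
  refine forall_congr' fun t => ?_
  rw [sum_mul_eq_zero_iff_of_chetaev (d := fun α i => dphi φ α i (vmOf η t) (xc t) t)]
  refine forall_congr' fun j => ?_
  suffices h : PoincareLHS ξ C0 C φ L xc η j t = _ by rw [h]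
  have hpL : ∀ k τ, pLstar L φ k (vmOf η τ) (xc τ) τ = pEta L (.inl k) (η τ) (xc τ) τ
      + ∑ α, pEta L (.inr α) (η τ) (xc τ) τ * dphi φ α k (vmOf η τ) (xc τ) τ := by
    intro k τ
    rw [pLstar_eq hφ1 hL1, hext]
  have hder : deriv (fun τ => pLstar L φ j (vmOf η τ) (xc τ) τ) t
      = deriv (fun τ => pEta L (.inl j) (η τ) (xc τ) τ) t
        + ∑ α, (deriv (fun τ => pEta L (.inr α) (η τ) (xc τ) τ) t
            * dphi φ α j (vmOf η t) (xc t) t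
          + pEta L (.inr α) (η t) (xc t) t
            * deriv (fun τ => dphi φ α j (vmOf η τ) (xc τ) τ) t) := by
    simp only [hpL]
    exact ((hLd (.inl j) t).hasDerivAt.add (HasDerivAt.fun_sum fun α _ =>
      (hLd (.inr α) t).hasDerivAt.mul (hdd α j t).hasDerivAt)).deriv
  have hX : Xstar ξ φ j (fun x' t' => Lstar L φ (vmOf η t) x' t') (vmOf η t) (xc t) t
      = Xp ξ (.inl j) (fun x' t' => L (η t) x' t') (xc t) t
        + ∑ β, dphi φ β j (vmOf η t) (xc t) t * Xp ξ (.inr β) (fun x' t' => L (η t) x' t') (xc t) t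
        + ∑ α, Xstar ξ φ j (fun x' t' => φ α (vmOf η t) x' t') (vmOf η t) (xc t) t
          * pEta L (.inr α) (η t) (xc t) t := by
    simp only [Xstar, Xp_Lstar_eq ξ hφ1 hL1, hext, mul_add, add_mul, Finset.sum_add_distrib,
      Finset.mul_sum, Finset.sum_mul]
    rw [Finset.sum_comm (f := fun β α => dphi φ β j (vmOf η t) (xc t) t
      * (pEta L (.inr α) (η t) (xc t) t * _))]
    simp only [mul_comm, mul_left_comm]
    ring
  let K : Idx m κ → ℝ := fun s => K0 C0 φ j s (vmOf η t) (xc t) t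
    + ∑ q, Kq C φ q j s (vmOf η t) (xc t) t * η t q
  have hA : ∀ α, Astar ξ C0 C φ xc (vmOf η) j α t
      = deriv (fun τ => dphi φ α j (vmOf η τ) (xc τ) τ) t
        - Xstar ξ φ j (fun x' t' => φ α (vmOf η t) x' t') (vmOf η t) (xc t) t
        + (K (.inr α) - ∑ k, K (.inl k) * dphi φ α k (vmOf η t) (xc t) t) := by
    intro α
    simp only [Astar, K, Fintype.sum_sum_type, hcon, vmOf, add_assoc]
    ring
  have hK : ∑ s, K s * pEta L s (η t) (xc t) t
      = (∑ q, C0 (.inl j) q (xc t) t * pEta L q (η t) (xc t) t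
        + ∑ q, ∑ r, C q (.inl j) r (xc t) t * η t q * pEta L r (η t) (xc t) t)
        + ∑ β, (∑ q, C0 (.inr β) q (xc t) t * pEta L q (η t) (xc t) t
          + ∑ q, ∑ r, C q (.inr β) r (xc t) t * η t q * pEta L r (η t) (xc t) t)
          * dphi φ β j (vmOf η t) (xc t) t := by
    have e1 : ∀ D : Idx m κ → Idx m κ → ℝ,
        ∑ q, ∑ r, D q r * η t q * pEta L r (η t) (xc t) t
          = ∑ r, (∑ q, D q r * η t q) * pEta L r (η t) (xc t) t := by
      intro D
      rw [Finset.sum_comm]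
      simp only [Finset.sum_mul]
    simp only [e1 fun q r => C q _ r (xc t) t, ← Finset.sum_add_distrib, ← add_mul]
    simp only [Finset.sum_mul]
    rw [Finset.sum_comm, ← Finset.sum_add_distrib]
    refine Finset.sum_congr rfl fun s _ => ?_
    simp only [K, K0, Kq, mul_right_comm _ (pEta L s (η t) (xc t) t), ← Finset.sum_mul, ← add_mul]
    congr 1
    simp only [add_mul, Finset.sum_add_distrib, Finset.sum_mul]
    rw [Finset.sum_comm (s := (Finset.univ : Finset (Fin κ)))]
    simp only [mul_right_comm _ _ (η t _)]
    ring
  have hsplit := sum_split_reduced K (fun s => pEta L s (η t) (xc t) t)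
    (fun α k => dphi φ α k (vmOf η t) (xc t) t)
  rw [hK] at hsplit
  rw [PoincareLHS, hder]
  simp only [hX, hA, hext, hpL]
  simp only [K, add_mul, sub_mul, Finset.sum_add_distrib, Finset.sum_sub_distrib] at hsplit ⊢
  simp only [mul_comm (dphi φ _ _ _ _ _), mul_comm (pEta L _ _ _ _) (deriv _ _)]
  linarith [hsplit]

end NNH
end
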